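/- arXiv:1904.08857 — 3 statements merged into one kernel-verified Lean document; each statement's English description precedes it below -/
import Mathlib

section
/- Let n ≥ 2 be an integer. Then in the polynomial ring ℤ[q], the polynomial 𝔣_{n-1}(q) is congruent to μ(n) modulo the n-th cyclotomic polynomial Φ_n(q), i.e. Φ_n(q) divides 𝔣_{n-1}(q) − μ(n), where μ is the Möbius function. -/
open Finset Polynomial

/-- The representative in `{1,…,n}` of a residue class `a : ZMod n`. -/
def zrep (n : ℕ) (a : ZMod n) : ℕ := if a.val = 0 then n else a.val

/-- The major index of a permutation of `{1,…,n}` (identified with `ZMod n`). -/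
def maj (n : ℕ) (σ : Equiv.Perm (ZMod n)) : ℕ :=
  ∑ i ∈ Finset.Icc 1 (n - 1),
    if zrep n (σ ((i : ZMod n) + 1)) < zrep n (σ (i : ZMod n)) then i else 0

/-- The cyclic major index. -/
def majbar (n : ℕ) (σ : Equiv.Perm (ZMod n)) : ℕ :=
  ∑ i ∈ Finset.Icc 1 n,
    if zrep n (σ ((i : ZMod n) + 1)) < zrep n (σ (i : ZMod n)) then i else 0

/-- The cyclic descent number. -/
def desbar (n : ℕ) (σ : Equiv.Perm (ZMod n)) : ℕ :=
  ((Finset.Icc 1 n).filter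
    (fun i : ℕ => zrep n (σ (((i : ℕ) : ZMod n) + 1)) < zrep n (σ ((i : ℕ) : ZMod n)))).card

/-- Conjugation by the rotation `a ↦ a + 1`. -/
def Tmap (n : ℕ) (σ : Equiv.Perm (ZMod n)) : Equiv.Perm (ZMod n) :=
  Equiv.addRight (1 : ZMod n) * σ * (Equiv.addRight (1 : ZMod n))⁻¹

section

variable {n : ℕ}

@[simp]
theorem zrep_zero : zrep n 0 = n := by simp [zrep]

theorem perm_apply_ne_apply_add_one (hn : 2 ≤ n) (σ : Equiv.Perm (ZMod n)) (i : ZMod n) :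
    σ i ≠ σ (i + 1) := by
  have : Fact (1 < n) := ⟨hn⟩
  simp

theorem Tmap_apply_add_one (σ : Equiv.Perm (ZMod n)) (i : ZMod n) :
    Tmap n σ (i + 1) = σ i + 1 := by
  simp [Tmap]

theorem addRight_zpow_apply (c : ZMod n) (k : ℤ) (x : ZMod n) :
    (Equiv.addRight c ^ k) x = x + k * c := by
  induction k generalizing x with
  | zero => simp
  | succ k ih =>
    rw [zpow_add_one, Equiv.Perm.mul_apply, ih, Equiv.coe_addRight]
    push_cast
    ring
  | pred k ih =>
    rw [zpow_sub_one, Equiv.Perm.mul_apply, ih, Equiv.Perm.inv_def, Equiv.addRight_symm,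
      Equiv.coe_addRight]
    push_cast
    ring

variable [NeZero n]

theorem zrep_pos (a : ZMod n) : 1 ≤ zrep n a := by
  have := NeZero.pos n
  unfold zrep
  split_ifs <;> omega

theorem zrep_le (a : ZMod n) : zrep n a ≤ n := by
  have := a.val_lt
  unfold zrep
  split_ifs <;> omega

theorem zrep_lt {a : ZMod n} (ha : a ≠ 0) : zrep n a < n := by
  have := a.val_lt
  rw [zrep, if_neg (by rwa [ZMod.val_eq_zero])]
  exact this

@[simp]
theorem natCast_zrep (a : ZMod n) : (zrep n a : ZMod n) = a := by
  unfold zrep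
  split_ifs with h
  · simp [(ZMod.val_eq_zero a).1 h]
  · simp

theorem zrep_eq_one (hn : 2 ≤ n) {a : ZMod n} : zrep n a = 1 ↔ a = 1 := by
  refine ⟨fun h => by rw [← natCast_zrep a, h, Nat.cast_one], ?_⟩
  rintro rfl
  simp [zrep, ZMod.val_one'' (show n ≠ 1 by omega)]

theorem zrep_add_one (a : ZMod n) :
    (zrep n (a + 1) : ℤ) = zrep n a + 1 - n * if a = 0 then 1 else 0 := by
  have hdvd : (n : ℤ) ∣ zrep n (a + 1) - (zrep n a + 1) := by
    rw [← ZMod.intCast_zmod_eq_zero_iff_dvd]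
    simp
  have h₁ := zrep_pos (a + 1)
  have h₂ := zrep_le (a + 1)
  split_ifs with h
  · subst h
    obtain ⟨k, hk⟩ := hdvd
    simp only [zrep_zero] at hk ⊢
    have hn : (0 : ℤ) < n := mod_cast NeZero.pos n
    have : k = -1 := by nlinarith [show k < 0 by nlinarith, show -2 < k by nlinarith]
    subst this
    linarith
  · have h₃ := zrep_lt h
    have := Int.eq_zero_of_abs_lt_dvd hdvd (by rw [abs_lt]; have := zrep_pos a; omega)
    linarith

theorem zrep_sub {a b : ZMod n} (hab : a ≠ b) :
    (n : ℤ) * (if zrep n b < zrep n a then 1 else 0) = zrep n a + zrep n (b - a) - zrep n b := by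
  have hdvd : (n : ℤ) ∣ zrep n a + zrep n (b - a) - zrep n b := by
    rw [← ZMod.intCast_zmod_eq_zero_iff_dvd]
    simp
  have ha := zrep_pos a
  have hb := zrep_pos b
  have ha' := zrep_le a
  have hb' := zrep_le b
  have hc := zrep_pos (b - a)
  have hc' := zrep_lt (sub_ne_zero.2 hab.symm)
  split_ifs with h
  · have := Int.eq_zero_of_abs_lt_dvd (hdvd.sub (dvd_refl _)) (by rw [abs_lt]; omega)
    linarith
  · have := Int.eq_zero_of_abs_lt_dvd hdvd (by rw [abs_lt]; omega)
    linarith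

/-- The indicator of a cyclic descent of `σ` at `i`. -/
def cyclicDescent (σ : Equiv.Perm (ZMod n)) (i : ZMod n) : ℤ :=
  if zrep n (σ (i + 1)) < zrep n (σ i) then 1 else 0

/-- The number of cyclic descents of `σ`. -/
def cyclicDes (σ : Equiv.Perm (ZMod n)) : ℤ := ∑ i, cyclicDescent σ i

theorem mul_cyclicDescent (hn : 2 ≤ n) (σ : Equiv.Perm (ZMod n)) (i : ZMod n) :
    n * cyclicDescent σ i = zrep n (σ i) + zrep n (σ (i + 1) - σ i) - zrep n (σ (i + 1)) :=
  zrep_sub (perm_apply_ne_apply_add_one hn σ i)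

theorem sum_add_one {M : Type*} [AddCommMonoid M] (f : ZMod n → M) :
    ∑ i, f (i + 1) = ∑ i, f i :=
  Equiv.sum_comp (Equiv.addRight (1 : ZMod n)) f

theorem mul_cyclicDes (hn : 2 ≤ n) (σ : Equiv.Perm (ZMod n)) :
    n * cyclicDes σ = ∑ i, (zrep n (σ (i + 1) - σ i) : ℤ) := by
  rw [cyclicDes, mul_sum]
  simp only [mul_cyclicDescent hn, sum_sub_distrib, sum_add_distrib]
  rw [sum_add_one (fun i => (zrep n (σ i) : ℤ))]
  ring

theorem card_le_sum_zrep (σ : Equiv.Perm (ZMod n)) :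
    (n : ℤ) ≤ ∑ i, (zrep n (σ (i + 1) - σ i) : ℤ) := by
  have := card_nsmul_le_sum univ (fun i => (zrep n (σ (i + 1) - σ i) : ℤ)) 1
    fun i _ => mod_cast zrep_pos _
  simpa using this

theorem cyclicDes_pos (hn : 2 ≤ n) (σ : Equiv.Perm (ZMod n)) : 1 ≤ cyclicDes σ := by
  have := card_le_sum_zrep σ
  rw [← mul_cyclicDes hn] at this
  have : (0 : ℤ) < n := by omega
  nlinarith

theorem cyclicDes_le (σ : Equiv.Perm (ZMod n)) : cyclicDes σ ≤ n := by
  have := sum_le_card_nsmul univ (cyclicDescent σ) 1 fun i _ => by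
    unfold cyclicDescent; split_ifs <;> simp
  simpa [cyclicDes] using this

theorem cyclicDes_eq_one_iff (hn : 2 ≤ n) {σ : Equiv.Perm (ZMod n)} :
    cyclicDes σ = 1 ↔ ∃ c, σ = Equiv.addRight c := by
  have hn' : (n : ℤ) ≠ 0 := by omega
  rw [← mul_right_inj' hn', mul_cyclicDes hn]
  constructor
  · intro h
    have hsum : ∑ _i : ZMod n, (1 : ℤ) = ∑ i, (zrep n (σ (i + 1) - σ i) : ℤ) := by simp [h]
    rw [sum_eq_sum_iff_of_le fun i _ => mod_cast zrep_pos _] at hsum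
    have hstep (i : ZMod n) : σ (i + 1) = σ i + 1 := by
      have := (zrep_eq_one hn).1 (mod_cast (hsum i (mem_univ i)).symm)
      rw [sub_eq_iff_eq_add'.1 this]
    have hnat (k : ℕ) : σ k = k + σ 0 := by
      induction k with
      | zero => simp
      | succ k ih => push_cast; rw [hstep, ih]; ring
    refine ⟨σ 0, Equiv.ext fun i => ?_⟩
    simpa using hnat i.val
  · rintro ⟨c, rfl⟩
    simp [(zrep_eq_one hn).2]

theorem cyclicDes_cast_eq_one_iff (hn : 2 ≤ n) {σ : Equiv.Perm (ZMod n)} :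
    (cyclicDes σ : ZMod n) = 1 ↔ ∃ c, σ = Equiv.addRight c := by
  rw [← cyclicDes_eq_one_iff hn]
  refine ⟨fun h => ?_, fun h => by simp [h]⟩
  have hdvd : (n : ℤ) ∣ cyclicDes σ - 1 := by
    rw [← ZMod.intCast_zmod_eq_zero_iff_dvd]
    simp [h]
  have := cyclicDes_pos hn σ
  have := cyclicDes_le σ
  have := Int.eq_zero_of_abs_lt_dvd hdvd (by rw [abs_lt]; omega)
  linarith

theorem maj_cast (σ : Equiv.Perm (ZMod n)) :
    (maj n σ : ZMod n) = ∑ i, i * (cyclicDescent σ i : ZMod n) := by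
  have hlt {i : ℕ} (hi : i ∈ Icc 1 (n - 1)) : i < n := by
    rw [mem_Icc] at hi; omega
  rw [maj, Nat.cast_sum]
  refine sum_of_injOn (fun i : ℕ => (i : ZMod n)) ?_ (by simp) ?_ ?_
  · intro i hi j hj h
    have := congrArg ZMod.val h
    simpa [ZMod.val_cast_of_lt (hlt hi), ZMod.val_cast_of_lt (hlt hj)] using this
  · intro i _ hi
    have : i = 0 := by
      by_contra h0
      refine hi ⟨i.val, ?_, by simp⟩
      have := i.val_lt
      have := (ZMod.val_ne_zero i).2 h0
      rw [mem_coe, mem_Icc]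
      omega
    simp [this]
  · intro i _
    unfold cyclicDescent
    split_ifs <;> simp

theorem cyclicDescent_Tmap (hn : 2 ≤ n) (σ : Equiv.Perm (ZMod n)) (i : ZMod n) :
    cyclicDescent (Tmap n σ) (i + 1) =
      cyclicDescent σ i - (if σ i = 0 then 1 else 0) + if σ (i + 1) = 0 then 1 else 0 := by
  have hn' : (n : ℤ) ≠ 0 := by omega
  refine mul_left_cancel₀ hn' ?_
  rw [mul_add, mul_sub, mul_cyclicDescent hn, mul_cyclicDescent hn]
  simp only [Tmap_apply_add_one, add_sub_add_right_eq_sub, zrep_add_one]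
  ring

theorem sum_mul_ite_apply_eq_zero (σ : Equiv.Perm (ZMod n)) (f : ZMod n → ZMod n) :
    ∑ i, f i * (if σ i = 0 then 1 else 0) = f (σ⁻¹ 0) := by
  simp [← Equiv.Perm.eq_inv_iff_eq]

theorem cyclicDes_Tmap_cast (hn : 2 ≤ n) (σ : Equiv.Perm (ZMod n)) :
    (cyclicDes (Tmap n σ) : ZMod n) = cyclicDes σ := by
  rw [cyclicDes, ← sum_add_one]
  simp only [cyclicDescent_Tmap hn, sum_add_distrib, sum_sub_distrib]
  rw [sum_add_one (fun i => if σ i = 0 then (1 : ℤ) else 0)]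
  simp [cyclicDes]

theorem maj_Tmap_cast (hn : 2 ≤ n) (σ : Equiv.Perm (ZMod n)) :
    (maj n (Tmap n σ) : ZMod n) = maj n σ + (cyclicDes σ - 1) := by
  have h := (sum_add_one (fun i => i * if σ i = 0 then (1 : ZMod n) else 0)).trans
    (sum_mul_ite_apply_eq_zero σ id)
  rw [maj_cast, maj_cast, ← sum_add_one]
  simp only [cyclicDescent_Tmap hn]
  push_cast
  simp only [mul_add, mul_sub, sum_add_distrib, sum_sub_distrib, h]
  rw [sum_mul_ite_apply_eq_zero σ (· + 1)]
  simp only [add_mul, one_mul, sum_add_distrib, cyclicDes, Int.cast_sum, id]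
  ring

theorem maj_addRight_cast (hn : 2 ≤ n) (c : ZMod n) :
    (maj n (Equiv.addRight c) : ZMod n) = -c := by
  have hdesc (i : ZMod n) : cyclicDescent (Equiv.addRight c) i = if i + c = 0 then 1 else 0 := by
    have hn' : (n : ℤ) ≠ 0 := by omega
    refine mul_left_cancel₀ hn' ?_
    rw [mul_cyclicDescent hn]
    simp only [Equiv.coe_addRight]
    rw [show i + 1 + c = i + c + 1 by ring, add_sub_cancel_left, (zrep_eq_one hn).2 rfl,
      zrep_add_one]
    push_cast
    ring
  rw [maj_cast]
  simp [hdesc, add_eq_zero_iff_eq_neg]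

theorem isCycle_addRight_iff (hn : 2 ≤ n) [DecidableEq (Equiv.Perm (ZMod n))] (c : ZMod n) :
    ((Equiv.addRight c).IsCycle ∧ (Equiv.addRight c).support.card = n) ↔ IsUnit c := by
  have : Fact (1 < n) := ⟨hn⟩
  constructor
  · rintro ⟨hc, hcard⟩
    have hsupp : (Equiv.addRight c).support = univ := by
      rw [← card_eq_iff_eq_univ, hcard, ZMod.card]
    have hmem (x : ZMod n) : Equiv.addRight c x ≠ x := by
      rw [← Equiv.Perm.mem_support, hsupp]; exact mem_univ x
    obtain ⟨k, hk⟩ := hc.sameCycle (hmem 0) (hmem 1)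
    rw [addRight_zpow_apply, zero_add] at hk
    exact IsUnit.of_mul_eq_one_right _ hk
  · intro hc
    have hsupp : (Equiv.addRight c).support = univ := by
      ext x; simp [hc.ne_zero]
    refine ⟨⟨0, by simp [hc.ne_zero], fun y _ => ?_⟩, by rw [hsupp, card_univ, ZMod.card]⟩
    obtain ⟨u, rfl⟩ := hc
    refine ⟨((y * ↑u⁻¹ : ZMod n).val : ℤ), ?_⟩
    rw [addRight_zpow_apply]
    simp

theorem sum_primitiveRoots_eq_moebius {n : ℕ} (hn : 0 < n) :
    ∑ ζ ∈ primitiveRoots n ℂ, ζ = (ArithmeticFunction.moebius n : ℂ) := by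
  have key : ∀ m > 0, ∑ d ∈ m.divisors, ∑ ζ ∈ primitiveRoots d ℂ, ζ = if m = 1 then 1 else 0 := by
    intro m hm
    have : NeZero m := ⟨hm.ne'⟩
    have hζ := Complex.isPrimitiveRoot_exp m hm.ne'
    have hroots : ∑ ζ ∈ nthRootsFinset m (1 : ℂ), ζ =
        ∑ k ∈ range m, Complex.exp (2 * Real.pi * Complex.I / m) ^ k := by
      rw [nthRootsFinset, ← Multiset.toFinset_eq hζ.nthRoots_one_nodup, sum_mk, Multiset.map_id',
        hζ.nthRoots_eq (one_pow m)]
      simp only [mul_one]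
      rfl
    rw [← sum_biUnion fun i _ j _ hij => IsPrimitiveRoot.disjoint hij,
      ← IsPrimitiveRoot.nthRoots_one_eq_biUnion_primitiveRoots, hroots]
    split_ifs with h
    · subst h
      simp
    · exact hζ.geom_sum_eq_zero (by omega)
  have := ArithmeticFunction.sum_eq_iff_sum_mul_moebius_eq.1 key n hn
  rw [← this, sum_eq_single (n, 1)]
  · simp
  · rintro ⟨a, b⟩ hab hne
    rw [if_neg, mul_zero]
    rintro rfl
    simp_all
  · simp [hn.ne']

theorem sum_isUnit_zmodChar [DecidablePred (IsUnit : ZMod n → Prop)] {ζ : ℂ}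
    (hζ : IsPrimitiveRoot ζ n) :
    ∑ c : ZMod n with IsUnit c, AddChar.zmodChar n hζ.pow_eq_one c =
      (ArithmeticFunction.moebius n : ℂ) := by
  rw [← sum_primitiveRoots_eq_moebius (NeZero.pos n)]
  have hunit (c : ZMod n) : IsUnit c ↔ c.val.Coprime n := by
    rw [← ZMod.isUnit_iff_coprime, ZMod.natCast_zmod_val]
  refine sum_nbij (AddChar.zmodChar n hζ.pow_eq_one) ?_ ?_ ?_ fun _ _ => rfl
  · intro c hc
    rw [mem_filter, hunit] at hc
    rw [mem_primitiveRoots (NeZero.pos n), AddChar.zmodChar_apply]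
    exact hζ.pow_of_coprime _ hc.2
  · intro a _ b _ hab
    simp only [AddChar.zmodChar_apply] at hab
    exact ZMod.val_injective n (hζ.pow_inj a.val_lt b.val_lt hab)
  · intro z hz
    rw [mem_coe, mem_primitiveRoots (NeZero.pos n), hζ.isPrimitiveRoot_iff] at hz
    obtain ⟨k, hk, hcop, rfl⟩ := hz
    refine ⟨k, ?_, by rw [AddChar.zmodChar_apply']⟩
    rw [mem_coe, mem_filter, ZMod.isUnit_iff_coprime]
    exact ⟨mem_univ _, hcop⟩

theorem sum_zmodChar_maj_eq_zero (hn : 2 ≤ n) {ζ : ℂ} (hζ : IsPrimitiveRoot ζ n)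
    {s : Finset (Equiv.Perm (ZMod n))} (hs : ∀ σ, Tmap n σ ∈ s ↔ σ ∈ s) {d : ZMod n}
    (hd : d ≠ 1) :
    ∑ σ ∈ s with (cyclicDes σ : ZMod n) = d, ζ ^ maj n σ = 0 := by
  set χ := AddChar.zmodChar n hζ.pow_eq_one
  have hmaj (σ : Equiv.Perm (ZMod n)) : ζ ^ maj n σ = χ (maj n σ) :=
    (AddChar.zmodChar_apply' hζ.pow_eq_one _).symm
  have hχ : χ (d - 1) ≠ 1 := by
    rw [Ne, (AddChar.zmodChar_primitive_of_primitive_root n hζ).zmod_char_eq_one_iff]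
    exact sub_ne_zero.2 hd
  set S := ∑ σ ∈ s with (cyclicDes σ : ZMod n) = d, ζ ^ maj n σ with hS
  have hshift : χ (d - 1) * S = S := by
    rw [hS, mul_sum]
    refine sum_equiv (MulAut.conj (Equiv.addRight (1 : ZMod n))).toEquiv ?_ ?_
    · intro σ
      change _ ↔ Tmap n σ ∈ _
      rw [mem_filter, mem_filter, hs, cyclicDes_Tmap_cast hn]
    · intro σ hσ
      change _ = ζ ^ maj n (Tmap n σ)
      rw [hmaj, hmaj, maj_Tmap_cast hn, (mem_filter.1 hσ).2, AddChar.map_add_eq_mul, mul_comm]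
  exact by_contra fun hS0 => hχ ((mul_eq_right₀ hS0).1 hshift)

end

open scoped Classical in
/-- a q-analogue of Wilson's congruence:
`𝔣_{n-1}(q) ≡ μ(n) (mod Φ_n(q))` in ℤ[q], for n ≥ 2. -/
theorem q_wilson (n : ℕ) [NeZero n] (hn : 2 ≤ n) :
    Polynomial.cyclotomic n ℤ ∣
      (∑ σ ∈ Finset.univ.filter
          (fun σ : Equiv.Perm (ZMod n) => σ.IsCycle ∧ σ.support.card = n),
        (Polynomial.X : Polynomial ℤ) ^ maj n σ) -
      Polynomial.C (ArithmeticFunction.moebius n : ℤ) := by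
  have hζ := Complex.isPrimitiveRoot_exp n (NeZero.ne n)
  set ζ := Complex.exp (2 * Real.pi * Complex.I / n)
  rw [cyclotomic_eq_minpoly hζ (NeZero.pos n)]
  refine minpoly.isIntegrallyClosed_dvd (hζ.isIntegral (NeZero.pos n)) ?_
  simp only [map_sub, map_sum, map_pow, aeval_X, eq_intCast, map_intCast]
  rw [sub_eq_zero]
  set s := Finset.univ.filter
    (fun σ : Equiv.Perm (ZMod n) => σ.IsCycle ∧ σ.support.card = n) with hs
  have hsT (σ : Equiv.Perm (ZMod n)) : Tmap n σ ∈ s ↔ σ ∈ s := by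
    have hcycle : (Tmap n σ).IsCycle ↔ σ.IsCycle := by
      refine ⟨fun h => ?_, fun h => h.conj⟩
      have := h.conj (g := (Equiv.addRight (1 : ZMod n))⁻¹)
      rwa [Tmap, inv_inv, mul_assoc, inv_mul_cancel_right, inv_mul_cancel_left] at this
    have hcard : (Tmap n σ).support.card = σ.support.card := Equiv.Perm.card_support_conj
    rw [hs, mem_filter_univ, mem_filter_univ, hcycle, hcard]
  rw [← sum_fiberwise s (fun σ => (cyclicDes σ : ZMod n)),
    sum_eq_single 1 (fun d _ hd => sum_zmodChar_maj_eq_zero hn hζ hsT hd) (by simp)]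
  refine Eq.trans ?_ (sum_isUnit_zmodChar hζ)
  symm
  refine sum_nbij (fun c => Equiv.addRight (-c)) ?_ ?_ ?_ ?_
  · intro c hc
    rw [mem_filter, hs, mem_filter, isCycle_addRight_iff hn, cyclicDes_cast_eq_one_iff hn]
    exact ⟨⟨mem_univ _, (mem_filter.1 hc).2.neg⟩, _, rfl⟩
  · intro a _ b _ hab
    simpa using Equiv.congr_fun hab 0
  · intro σ hσ
    rw [mem_coe, mem_filter, cyclicDes_cast_eq_one_iff hn] at hσ
    obtain ⟨hσs, c, rfl⟩ := hσ
    rw [hs, mem_filter, isCycle_addRight_iff hn] at hσs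
    exact ⟨-c, by simpa using hσs.2, by simp⟩
  · intro c _
    rw [← AddChar.zmodChar_apply' hζ.pow_eq_one, maj_addRight_cast hn, neg_neg]
end

section
/- Let n ≥ 2 and let σ be a cycle of length n on {1,…,n} (identified with ℤ/nℤ). Then the cyclic major index satisfies maj̄(Tσ) ≡ maj̄(σ) + des̄(σ) − 1 (mod n), where Tσ := τ∘σ∘τ^{-1} and τ(a) = a+1 mod n. -/
open Finset Polynomial

theorem zrep_add_one_s3 {n : ℕ} [NeZero n] (hn : 2 ≤ n) (a : ZMod n) :
    zrep n (a + 1) = a.val + 1 := by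
  have : Fact (1 < n) := ⟨hn⟩
  have ha := a.val_lt
  unfold zrep
  rw [ZMod.val_add, ZMod.val_one]
  rcases Nat.lt_or_ge (a.val + 1) n with h | h
  · simp [Nat.mod_eq_of_lt h]
  · have h' : a.val + 1 = n := by omega
    simp [h']

theorem zrep_add_one_lt_indicator {n : ℕ} [NeZero n] (hn : 2 ≤ n) (R : Type*) [Ring R]
    (a b : ZMod n) :
    (if zrep n (a + 1) < zrep n (b + 1) then (1 : R) else 0) =
      (if zrep n a < zrep n b then 1 else 0) + (if a = 0 then 1 else 0) -
        (if b = 0 then 1 else 0) := by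
  rw [zrep_add_one_s3 hn, zrep_add_one_s3 hn]
  have ha := a.val_lt
  have hb := b.val_lt
  simp only [zrep, ← ZMod.val_eq_zero]
  split_ifs <;> first | omega | simp

theorem sum_Icc_natCast_zmod {n : ℕ} [NeZero n] {M : Type*} [AddCommMonoid M] (f : ZMod n → M) :
    ∑ i ∈ Finset.Icc 1 n, f (i : ZMod n) = ∑ x, f x := by
  refine Finset.sum_bij (fun i _ => (i : ZMod n)) (fun _ _ => Finset.mem_univ _) ?_ ?_
    (fun _ _ => rfl)
  · intro i hi j hj h
    rw [Finset.mem_Icc] at hi hj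
    rw [ZMod.natCast_eq_natCast_iff, Nat.modEq_iff_dvd] at h
    obtain ⟨k, hk⟩ := h
    have h1 : k < 1 := by nlinarith
    have h2 : -1 < k := by nlinarith
    obtain rfl : k = 0 := by omega
    omega
  · intro x _
    refine ⟨zrep n x, ?_, ?_⟩
    · have := x.val_lt
      rw [Finset.mem_Icc]
      unfold zrep
      split_ifs <;> omega
    · unfold zrep
      split_ifs with h
      · simpa using ((ZMod.val_eq_zero x).mp h).symm
      · exact ZMod.natCast_zmod_val x

theorem majbar_natCast_zmod (n : ℕ) [NeZero n] (σ : Equiv.Perm (ZMod n)) :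
    (majbar n σ : ZMod n) =
      ∑ x : ZMod n, (if zrep n (σ (x + 1)) < zrep n (σ x) then 1 else 0) * x := by
  rw [← sum_Icc_natCast_zmod, majbar, Nat.cast_sum]
  simp

theorem desbar_natCast_zmod (n : ℕ) [NeZero n] (σ : Equiv.Perm (ZMod n)) :
    (desbar n σ : ZMod n) =
      ∑ x : ZMod n, if zrep n (σ (x + 1)) < zrep n (σ x) then 1 else 0 := by
  rw [← sum_Icc_natCast_zmod, desbar, Finset.card_filter, Nat.cast_sum]
  simp

/-- `maj̄(Tσ) ≡ maj̄(σ) + des̄(σ) - 1 (mod n)` for an n-cycle σ. -/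
theorem majbar_Tmap (n : ℕ) [NeZero n] (hn : 2 ≤ n) (σ : Equiv.Perm (ZMod n))
    (hc : σ.IsCycle) (hs : σ.support.card = n) :
    (majbar n (Tmap n σ) : ℤ) ≡ (majbar n σ : ℤ) + (desbar n σ : ℤ) - 1 [ZMOD (n : ℤ)] := by
  rw [← ZMod.intCast_eq_intCast_iff]
  push_cast
  have hT (x : ZMod n) : Tmap n σ (x + 1) = σ x + 1 := by simp [Tmap]
  have hσ (x : ZMod n) : σ x = 0 ↔ x = σ.symm 0 := by rw [Equiv.eq_symm_apply]
  rw [majbar_natCast_zmod, majbar_natCast_zmod, desbar_natCast_zmod,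
    ← Equiv.sum_comp (Equiv.addRight (1 : ZMod n))]
  simp only [Equiv.coe_addRight, hT, zrep_add_one_lt_indicator hn (ZMod n), hσ, ← eq_sub_iff_add_eq,
    add_mul, sub_mul, mul_add, mul_one, Finset.sum_add_distrib, Finset.sum_sub_distrib, ite_mul, one_mul,
    zero_mul, Finset.sum_ite_eq', Finset.mem_univ, if_true]
  ring
end

section
/- Let p be a prime and let a be an integer with p ∤ a (for instance 1 ≤ a ≤ p−1). Then in ℤ[q], Π_{k=1}^{p−1} [a]_{q^k} ≡ 1 modulo [p]_q, where [a]_{q^k} := 1 + q^k + q^{2k} + ⋯ + q^{(a−1)k} and [p]_q := 1 + q + ⋯ + q^{p−1}. -/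
open Finset Polynomial

/-- Multiplication by a number prime to `p` permutes the nonzero residues modulo `p`. -/
theorem Nat.Prime.prod_Icc_mul_mod {M : Type*} [CommMonoid M] {p : ℕ} (hp : p.Prime) {a : ℕ}
    (ha : ¬ p ∣ a) (f : ℕ → M) :
    ∏ k ∈ Finset.Icc 1 (p - 1), f (a * k % p) = ∏ k ∈ Finset.Icc 1 (p - 1), f k := by
  have h_maps : Set.MapsTo (fun k => a * k % p) (Finset.Icc 1 (p - 1) : Finset ℕ)
      (Finset.Icc 1 (p - 1) : Finset ℕ) := by
    intro k hk
    simp only [Finset.coe_Icc, Set.mem_Icc] at hk ⊢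
    have h_lt := Nat.mod_lt (a * k) hp.pos
    have h_ne : a * k % p ≠ 0 := fun h => by
      rcases hp.dvd_mul.1 (Nat.dvd_of_mod_eq_zero h) with h | h
      · exact ha h
      · have := Nat.le_of_dvd (by omega) h
        omega
    omega
  have h_inj : Set.InjOn (fun k => a * k % p) (Finset.Icc 1 (p - 1) : Finset ℕ) := by
    intro k hk l hl h
    simp only [Finset.coe_Icc, Set.mem_Icc] at hk hl
    have h_modEq : k ≡ l [MOD p] :=
      Nat.ModEq.cancel_left_of_coprime ((Nat.Prime.coprime_iff_not_dvd hp).2 ha) h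
    exact h_modEq.eq_of_lt_of_lt (by omega) (by omega)
  exact Finset.prod_nbij (fun k => a * k % p) (fun k hk => h_maps hk) h_inj
    (Finset.surjOn_of_injOn_of_card_le _ h_maps h_inj le_rfl) fun _ _ => rfl

/-- For a primitive `p`-th root of unity `ζ` and `p ∤ a`, the product of the cyclotomic units
`(ζ ^ (a * k) - 1) / (ζ ^ k - 1)` over `1 ≤ k ≤ p - 1` is `1`. -/
theorem IsPrimitiveRoot.prod_geom_sum_eq_one {R : Type*} [CommRing R] [IsDomain R] {ζ : R} {p : ℕ}
    (hζ : IsPrimitiveRoot ζ p) (hp : p.Prime) {a : ℕ} (ha : ¬ p ∣ a) :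
    ∏ k ∈ Finset.Icc 1 (p - 1), ∑ j ∈ Finset.range a, ζ ^ (j * k) = 1 := by
  have h_ne : ∏ k ∈ Finset.Icc 1 (p - 1), (ζ ^ k - 1) ≠ 0 := by
    refine Finset.prod_ne_zero_iff.2 fun k hk => sub_ne_zero.2 ?_
    rw [Finset.mem_Icc] at hk
    exact hζ.pow_ne_one_of_pos_of_lt (by omega) (by omega)
  refine mul_right_cancel₀ h_ne ?_
  rw [one_mul, ← Finset.prod_mul_distrib, ← hp.prod_Icc_mul_mod ha fun k => ζ ^ k - 1]
  refine Finset.prod_congr rfl fun k _ => ?_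
  simp_rw [mul_comm _ k, pow_mul]
  rw [geom_sum_mul, ← pow_mul, mul_comm k a, hζ.eq_orderOf, pow_mod_orderOf]

/-- a q-analogue of Fermat's congruence:
`Π_{k=1}^{p-1} [a]_{q^k} ≡ 1 (mod [p]_q)` in ℤ[q] when p ∤ a. -/
theorem q_fermat (p : ℕ) (hp : p.Prime) (a : ℕ) (ha : ¬ p ∣ a) :
    (∑ i ∈ Finset.range p, (Polynomial.X : Polynomial ℤ) ^ i) ∣
      (∏ k ∈ Finset.Icc 1 (p - 1),
        ∑ j ∈ Finset.range a, (Polynomial.X : Polynomial ℤ) ^ (j * k)) - 1 := by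
  have := Fact.mk hp
  have hζ := Complex.isPrimitiveRoot_exp p hp.ne_zero
  rw [← Polynomial.cyclotomic_prime ℤ p, Polynomial.cyclotomic_eq_minpoly hζ hp.pos]
  refine minpoly.isIntegrallyClosed_dvd (hζ.isIntegral hp.pos) ?_
  simp only [map_sub, map_prod, map_sum, map_pow, Polynomial.aeval_X, map_one]
  rw [hζ.prod_geom_sum_eq_one hp ha, sub_self]
end
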